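/- Let 0 ≤ t < T and let x ∈ ℝ⁴ satisfy x₁ < x₂ < x₃ < x₄ (so that x^o = x and θ·x < 0). Then for all i, j ∈ {1,2,3,4} the second partial derivative ∂²_{x_i x_j} u^T(t,x) exists and equals (1/(16√2)) ∫_{−∞}^{∞} e^{−(T−t) r²} Σ_{k=1}^4 α_{k,i} α_{k,j} [ ψ(r θ·x + π/2) cos(r α_k·x) − ψ(r θ·x) sin(r α_k·x) ] dr + (θ_j/(16√2)) Σ_{l∈ℤ} ((−1)^l e^{−(T−t) π² (l+1/2)² / (θ·x)²} / (θ·x)) Σ_{k=1}^4 2 α_{k,i} sin( (α_k·x) π (l+1/2) / (θ·x) ) − (θ_j/(16√2)) Σ_{l∈ℤ} ((−1)^l e^{−(T−t) π² l² / (θ·x)²} / (θ·x)) Σ_{k=1}^4 2 α_{k,i} cos( (α_k·x) π l / (θ·x) ), where θ_j denotes the j-th component of θ. -/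

import Mathlib

open MeasureTheory Finset

noncomputable section

/-- The 2π-periodic square wave ψ(r) = sign(sin r). -/
def psi (r : ℝ) : ℝ := Real.sign (Real.sin r)

/-- The vectors α_k ∈ ℝ⁴, α_{k,j} = 3/√2 if k = j and −1/√2 otherwise. -/
def alph : Fin 4 → Fin 4 → ℝ := fun k j => if k = j then 3 / Real.sqrt 2 else -(1 / Real.sqrt 2)

/-- The vector θ = (1/√2)(1,1,−1,−1) ∈ ℝ⁴. -/
def theta : Fin 4 → ℝ :=
  ![1 / Real.sqrt 2, 1 / Real.sqrt 2, -(1 / Real.sqrt 2), -(1 / Real.sqrt 2)]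

/-- Euclidean dot product on ℝ⁴. -/
def dot (a b : Fin 4 → ℝ) : ℝ := ∑ j, a j * b j

/-- The auxiliary function Λ(r,x). -/
def Lam (r : ℝ) (x : Fin 4 → ℝ) : ℝ :=
  psi (r * dot theta x + Real.pi / 2) * (∑ k, Real.cos (r * dot (alph k) x)) - 4
    - psi (r * dot theta x) * (∑ k, Real.sin (r * dot (alph k) x))

/-- x^o : the increasing rearrangement of the coordinates of x. -/
def sortv (x : Fin 4 → ℝ) : Fin 4 → ℝ := fun i => x (Tuple.sort x i)

/-- The function u^T(t,x). -/
def u (T t : ℝ) (x : Fin 4 → ℝ) : ℝ :=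
  -(1 / (16 * Real.sqrt 2)) *
      (∫ r : ℝ, Real.exp (-(T - t) * r ^ 2) * Lam r (sortv x) / r ^ 2)
    + (1 / 4) * ∑ i, x i + (1 / 2) * Real.sqrt ((T - t) * Real.pi / 2)

/-- Partial derivative in the i-th coordinate. -/
def pd (i : Fin 4) (f : (Fin 4 → ℝ) → ℝ) (x : Fin 4 → ℝ) : ℝ :=
  deriv (fun s => f (Function.update x i s)) (x i)


lemma psi_abs_le (r : ℝ) : |psi r| ≤ 1 := by
  unfold psi
  rcases Real.sign_apply_eq (Real.sin r) with h | h | h <;> simp [h]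

lemma psi_meas : Measurable psi := by
  have : psi = fun r => if Real.sin r < 0 then (-1:ℝ) else if 0 < Real.sin r then 1 else 0 := by
    funext r; rfl
  rw [this]
  refine Measurable.ite ?_ measurable_const (Measurable.ite ?_ measurable_const measurable_const)
  · exact measurableSet_lt Real.measurable_sin measurable_const
  · exact measurableSet_lt measurable_const Real.measurable_sin

lemma psi_on (n : ℤ) (w : ℝ) (h1 : (n:ℝ) < w) (h2 : w < n + 1) :
    psi (Real.pi * w) = (-1 : ℝ) ^ n := by
  have hp := Real.pi_pos
  have e : Real.sin (Real.pi * w) = (-1 : ℝ)^n * Real.sin (Real.pi * (w - n)) := by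
    rw [← Real.sin_add_int_mul_pi]; congr 1; ring
  have hs : 0 < Real.sin (Real.pi * (w - n)) := by
    apply Real.sin_pos_of_pos_of_lt_pi <;> nlinarith
  unfold psi
  rw [e]
  rcases Int.even_or_odd n with h | h
  · rw [h.neg_one_zpow, one_mul, Real.sign_of_pos hs]
  · rw [h.neg_one_zpow, Real.sign_of_neg (by linarith)]

lemma jump (g g' : ℝ → ℝ) (d : ℝ) (hg : ∀ v, HasDerivAt g (g' v) v) (hc : Continuous g')
    (hi : Integrable g') (hs : Summable (fun n : ℤ => g (Real.pi * n - d))) :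
    ∫ v, psi (v + d) * g' v = -2 * ∑' n : ℤ, (-1 : ℝ) ^ n * g (Real.pi * n - d) := by
  have hp := Real.pi_pos
  set h : ℝ → ℝ := fun w => psi (Real.pi * w) * g' (Real.pi * w - d) with hh
  have e1 : ∫ w, h w = Real.pi⁻¹ * ∫ v, psi (v + d) * g' v := by
    have := Measure.integral_comp_mul_left (fun v => psi v * g' (v - d)) Real.pi
    rw [hh, this, abs_of_pos (inv_pos.2 hp), smul_eq_mul]
    congr 1
    rw [← integral_add_right_eq_self (fun v => psi v * g' (v - d)) d]
    simp
  have hint : Integrable h := by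
    have a1 : Integrable (fun w => g' (Real.pi * w - d)) :=
      (hi.comp_sub_right d).comp_mul_left' hp.ne'
    refine a1.bdd_mul (c := 1) ?_ ?_
    · exact (psi_meas.comp (measurable_const.mul measurable_id)).aestronglyMeasurable
    · exact Filter.Eventually.of_forall fun w => psi_abs_le _
  have hsum := hint.hasSum_intervalIntegral 0
  have e2 : ∀ n : ℤ, ∫ x in (0:ℝ) + n..0 + n + 1, h x =
      Real.pi⁻¹ * ((-1 : ℝ)^n * g (Real.pi * ((n + 1 : ℤ) : ℝ) - d) - (-1 : ℝ)^n * g (Real.pi * n - d)) := by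
    intro n
    have : ∫ x in (0:ℝ) + n..0 + n + 1, h x =
        ∫ x in (0:ℝ) + n..0 + n + 1, (-1 : ℝ)^n * g' (Real.pi * x - d) := by
      rw [intervalIntegral.integral_of_le (by linarith), intervalIntegral.integral_of_le (by linarith),
        integral_Ioc_eq_integral_Ioo, integral_Ioc_eq_integral_Ioo]
      apply setIntegral_congr_fun measurableSet_Ioo
      intro w hw
      simp only [zero_add, Set.mem_Ioo] at hw
      simp only [hh]
      rw [psi_on n w hw.1 hw.2]
    rw [this, intervalIntegral.integral_const_mul,
      intervalIntegral.integral_comp_mul_sub (fun x => g' x) hp.ne',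
      intervalIntegral.integral_eq_sub_of_hasDerivAt (fun x _ => hg x) (hc.intervalIntegrable _ _)]
    simp only [zero_add, smul_eq_mul]
    push_cast
    ring
  simp_rw [e2] at hsum
  have s1 : Summable (fun n : ℤ => (-1 : ℝ)^n * g (Real.pi * n - d)) := by
    apply Summable.of_norm
    refine hs.norm.congr ?_
    intro n
    rw [norm_mul, norm_zpow]; simp
  have s2 : HasSum (fun n : ℤ => (-1 : ℝ)^(n+1) * g (Real.pi * ((n + 1 : ℤ):ℝ) - d))
      (∑' n : ℤ, (-1 : ℝ)^n * g (Real.pi * n - d)) := by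
    have := (Equiv.hasSum_iff (Equiv.addRight (1:ℤ))).2 s1.hasSum
    exact this
  have s3 := ((s2.neg.sub s1.hasSum).mul_left Real.pi⁻¹)
  have s4 := hsum.unique (s3.congr_fun ?_)
  · rw [e1] at s4
    have := mul_left_cancel₀ (inv_pos.2 hp).ne' s4
    rw [this]; ring
  · intro n
    rw [zpow_add_one₀ (by norm_num)]
    ring

lemma gauss_summable (c d : ℝ) (hc : 0 < c) :
    Summable (fun n : ℤ => Real.exp (-c * (Real.pi * n - d) ^ 2)) := by
  have hp := Real.pi_pos
  have h := ((Real.summable_one_div_int_add_rpow (-d / Real.pi) 2).2 (by norm_num)).mul_left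
    (1 / (c * Real.pi ^ 2))
  refine Summable.of_norm_bounded_eventually h ?_
  have hfin : {n : ℤ | (n : ℝ) + -d / Real.pi = 0}.Finite := by
    apply Set.Subsingleton.finite
    intro a ha b hb
    simp only [Set.mem_ofPred_eq] at ha hb
    have : (a : ℝ) = b := by linarith
    exact_mod_cast this
  filter_upwards [hfin.compl_mem_cofinite] with n hn
  have hn' : (n : ℝ) + -d / Real.pi ≠ 0 := hn
  set y := (n : ℝ) + -d / Real.pi with hy
  have e : Real.pi * n - d = Real.pi * y := by rw [hy]; field_simp; ring
  have : |y| ^ (2:ℝ) = y ^ 2 := by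
    rw [show (2:ℝ) = ((2:ℕ):ℝ) by norm_num, Real.rpow_natCast, sq_abs]
  rw [this, e, Real.norm_eq_abs, abs_of_pos (Real.exp_pos _)]
  have hy2 : 0 < y ^ 2 := by positivity
  rw [neg_mul, Real.exp_neg, div_mul_div_comm, ← one_div, one_mul]
  apply one_div_le_one_div_of_le (by positivity)
  have := Real.add_one_le_exp (c * (Real.pi * y)^2)
  nlinarith

lemma sign_lip (q G : ℝ → ℝ) (hq : Continuous q) (h0 : ∀ s, q s = 0 → G s = 0) (L s s' : ℝ)
    (hL : ∀ a ∈ Set.uIcc s s', ∀ b ∈ Set.uIcc s s', |G a - G b| ≤ L * |a - b|) :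
    |Real.sign (q s) * G s - Real.sign (q s') * G s'| ≤ L * |s - s'| := by
  have m1 : s ∈ Set.uIcc s s' := Set.left_mem_uIcc
  have m2 : s' ∈ Set.uIcc s s' := Set.right_mem_uIcc
  have key : ∀ z ∈ Set.uIcc s s', q z = 0 →
      |Real.sign (q s) * G s - Real.sign (q s') * G s'| ≤ L * |s - s'| := by
    intro z hz hqz
    have hGz := h0 z hqz
    have a1 := hL s m1 z hz
    have a2 := hL z hz s' m2
    have e : |s - z| + |z - s'| = |s - s'| := by
      rcases le_total s s' with h | h
      · rw [Set.uIcc_of_le h] at hz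
        rw [abs_of_nonpos (by linarith [hz.1]), abs_of_nonpos (by linarith [hz.2]), abs_of_nonpos (by linarith)]
        ring
      · rw [Set.uIcc_of_ge h] at hz
        rw [abs_of_nonneg (by linarith [hz.2]), abs_of_nonneg (by linarith [hz.1]), abs_of_nonneg (by linarith)]
        ring
    have b : ∀ w, |Real.sign w| ≤ 1 := by
      intro w
      rcases Real.sign_apply_eq w with h | h | h <;> simp [h]
    rw [hGz, sub_zero] at a1
    rw [hGz, zero_sub, abs_neg] at a2
    calc _ ≤ |Real.sign (q s) * G s| + |Real.sign (q s') * G s'| := abs_sub _ _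
      _ ≤ 1 * |G s| + 1 * |G s'| := by
        rw [abs_mul, abs_mul]; gcongr <;> exact b _
      _ ≤ L * |s - z| + L * |z - s'| := by linarith
      _ = _ := by rw [← e]; ring
  by_cases hz : (0:ℝ) ∈ Set.uIcc (q s) (q s')
  · obtain ⟨z, hz, hz'⟩ := intermediate_value_uIcc hq.continuousOn hz
    exact key z hz hz'
  · have a1 := hL s m1 s' m2
    rw [Set.mem_uIcc] at hz
    push Not at hz
    rcases lt_trichotomy (q s) 0 with h | h | h
    · have := hz.1 h.le
      rw [Real.sign_of_neg h, Real.sign_of_neg this]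
      rw [show -1 * G s - -1 * G s' = -(G s - G s') by ring, abs_neg]; exact a1
    · exact key s m1 h
    · have h' : 0 < q s' := by
        by_contra hcon
        push Not at hcon
        linarith [hz.2 hcon]
      rw [Real.sign_of_pos h, Real.sign_of_pos h', one_mul, one_mul]; exact a1

/-- Restriction of one of the two oscillating terms to a line. -/
def RR (d' d a0 a1 : ℝ) (b p : Fin 4 → ℝ) (r s : ℝ) : ℝ :=
  psi (r * (a0 + a1 * s) + d') * ∑ k, Real.sin (r * (b k + p k * s) + d)

lemma RR_lip (d' d a0 a1 : ℝ) (b p : Fin 4 → ℝ) (hp : ∑ k, p k = 0)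
    (hz : ∀ r s, Real.sin (r * (a0 + a1 * s) + d') = 0 →
      ∑ k, Real.sin (r * (b k + p k * s) + d) = 0) (r s s' : ℝ)
    (hs : s ∈ Set.Icc (-1:ℝ) 1) (hs' : s' ∈ Set.Icc (-1:ℝ) 1) :
    |RR d' d a0 a1 b p r s - RR d' d a0 a1 b p r s'| ≤
      ((∑ k, |p k| * (|b k| + |p k|)) * r ^ 2) * |s - s'| := by
  unfold RR psi
  apply sign_lip (fun s => Real.sin (r * (a0 + a1 * s) + d'))
    (fun s => ∑ k, Real.sin (r * (b k + p k * s) + d)) (by fun_prop) (hz r)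
  intro u hu v hv
  have hsub : Set.uIcc s s' ⊆ Set.Icc (-1:ℝ) 1 := Set.uIcc_subset_Icc hs hs'
  have hd : ∀ x ∈ Set.Icc (-1:ℝ) 1, HasDerivWithinAt
      (fun s => ∑ k, Real.sin (r * (b k + p k * s) + d))
      (∑ k, Real.cos (r * (b k + p k * x) + d) * (r * p k)) (Set.Icc (-1:ℝ) 1) x := by
    intro x _
    apply HasDerivAt.hasDerivWithinAt
    apply HasDerivAt.fun_sum
    intro k _
    apply HasDerivAt.sin
    have := ((((hasDerivAt_id x).const_mul (p k)).const_add (b k)).const_mul r).add_const d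
    simpa using this
  refine Convex.norm_image_sub_le_of_norm_hasDerivWithin_le hd ?_ (convex_Icc _ _) (hsub hv) (hsub hu)
  intro x hx
  have hx1 : |x| ≤ 1 := abs_le.2 hx
  have e : ∑ k, Real.cos (r * (b k + p k * x) + d) * (r * p k) =
      ∑ k, (Real.cos (r * (b k + p k * x) + d) - Real.cos d) * (r * p k) := by
    simp_rw [sub_mul]
    rw [Finset.sum_sub_distrib, ← Finset.mul_sum, ← Finset.mul_sum, hp]
    ring
  rw [e, Finset.sum_mul]
  refine (norm_sum_le _ _).trans (Finset.sum_le_sum fun k _ => ?_)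
  rw [norm_mul, Real.norm_eq_abs, Real.norm_eq_abs]
  have h1 := Real.abs_cos_sub_cos_le (r * (b k + p k * x) + d) d
  have h2 : |b k + p k * x| ≤ |b k| + |p k| := by
    calc _ ≤ |b k| + |p k * x| := abs_add_le _ _
      _ ≤ |b k| + |p k| * 1 := by rw [abs_mul]; gcongr
      _ = _ := by ring
  calc _ ≤ (|r| * (|b k| + |p k|)) * |r * p k| := by
        gcongr
        refine h1.trans ?_
        rw [add_sub_cancel_right, abs_mul]; gcongr
    _ = _ := by rw [abs_mul, ← sq_abs r]; ring

lemma RR_meas (d' d a0 a1 : ℝ) (b p : Fin 4 → ℝ) (s : ℝ) :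
    Measurable (fun r => RR d' d a0 a1 b p r s) := by
  unfold RR
  apply Measurable.mul
  · exact psi_meas.comp (by fun_prop)
  · fun_prop

lemma ae_sin (a d : ℝ) (ha : a ≠ 0) : ∀ᵐ r : ℝ, Real.sin (r * a + d) ≠ 0 := by
  have hc : {r : ℝ | Real.sin (r * a + d) = 0}.Countable := by
    apply (Set.countable_range (fun n : ℤ => (n * Real.pi - d) / a)).mono
    intro r hr
    obtain ⟨n, hn⟩ := Real.sin_eq_zero_iff.1 hr
    refine ⟨n, ?_⟩
    simp only [hn]; field_simp; ring
  filter_upwards [hc.ae_notMem volume] with r hr h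
  exact hr h

lemma D0 (τ : ℝ) (hτ : 0 < τ) (d' d κ a0 a1 : ℝ) (ha : a0 ≠ 0) (b p : Fin 4 → ℝ) (hp : ∑ k, p k = 0)
    (hz : ∀ r s, Real.sin (r * (a0 + a1 * s) + d') = 0 →
      ∑ k, Real.sin (r * (b k + p k * s) + d) = 0)
    (hi : Integrable (fun r => Real.exp (-τ * r ^ 2) * (RR d' d a0 a1 b p r 0 - κ) / r ^ 2)) :
    HasDerivAt (fun s => ∫ r, Real.exp (-τ * r ^ 2) * (RR d' d a0 a1 b p r s - κ) / r ^ 2)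
      (∫ r, Real.exp (-τ * r ^ 2) / r * (psi (r * a0 + d') *
        ∑ k, p k * Real.sin (r * b k + (d + Real.pi / 2)))) 0 := by
  set K := ∑ k, |p k| * (|b k| + |p k|) with hK
  have hK0 : 0 ≤ K := Finset.sum_nonneg fun k _ => by positivity
  refine (hasDerivAt_integral_of_dominated_loc_of_lip (s := Set.Icc (-1:ℝ) 1)
    (bound := fun r => K * Real.exp (-τ * r ^ 2)) (Icc_mem_nhds (by norm_num) (by norm_num)) ?_ hi ?_ ?_ ?_ ?_).2
  · refine Filter.Eventually.of_forall fun s => Measurable.aestronglyMeasurable ?_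
    have := RR_meas d' d a0 a1 b p s
    fun_prop
  · apply Measurable.aestronglyMeasurable
    apply Measurable.mul (by fun_prop)
    apply Measurable.mul
    · exact psi_meas.comp (by fun_prop)
    · fun_prop
  · refine Filter.Eventually.of_forall fun r => ?_
    apply LipschitzOnWith.of_dist_le_mul
    intro s hs s' hs'
    have h := RR_lip d' d a0 a1 b p hp hz r s s' hs hs'
    rw [Real.dist_eq, Real.dist_eq, Real.coe_nnabs,
      abs_of_nonneg (show 0 ≤ K * Real.exp (-τ * r ^ 2) by positivity)]
    by_cases hr : r = 0
    · subst hr; simp; positivity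
    have e : Real.exp (-τ * r ^ 2) * (RR d' d a0 a1 b p r s - κ) / r ^ 2 -
        Real.exp (-τ * r ^ 2) * (RR d' d a0 a1 b p r s' - κ) / r ^ 2 =
        (Real.exp (-τ * r ^ 2) / r ^ 2) * (RR d' d a0 a1 b p r s - RR d' d a0 a1 b p r s') := by ring
    rw [e, abs_mul, abs_of_nonneg (show 0 ≤ Real.exp (-τ * r ^ 2) / r ^ 2 by positivity)]
    calc _ ≤ (Real.exp (-τ * r ^ 2) / r ^ 2) * ((K * r ^ 2) * |s - s'|) := by gcongr
      _ = _ := by field_simp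
  · exact (integrable_exp_neg_mul_sq hτ).const_mul K
  · filter_upwards [ae_sin a0 d' ha] with r hr
    have hd : HasDerivAt (fun s => ∑ k, Real.sin (r * (b k + p k * s) + d))
        (∑ k, Real.cos (r * (b k + p k * 0) + d) * (r * p k)) 0 := by
      apply HasDerivAt.fun_sum
      intro k _
      apply HasDerivAt.sin
      have := ((((hasDerivAt_id (0:ℝ)).const_mul (p k)).const_add (b k)).const_mul r).add_const d
      simpa using this
    have hev : ∀ᶠ s in nhds (0:ℝ), psi (r * (a0 + a1 * s) + d') = psi (r * a0 + d') := by
      have hcont : ContinuousAt (fun s => Real.sin (r * (a0 + a1 * s) + d')) 0 := by fun_prop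
      rcases lt_or_gt_of_ne hr with h | h
      · have : ∀ᶠ s in nhds (0:ℝ), Real.sin (r * (a0 + a1 * s) + d') < 0 :=
          hcont.eventually_lt continuousAt_const (by simpa using h)
        filter_upwards [this] with s hs
        unfold psi; rw [Real.sign_of_neg hs, Real.sign_of_neg h]
      · have : ∀ᶠ s in nhds (0:ℝ), 0 < Real.sin (r * (a0 + a1 * s) + d') :=
          continuousAt_const.eventually_lt hcont (by simpa using h)
        filter_upwards [this] with s hs
        unfold psi; rw [Real.sign_of_pos hs, Real.sign_of_pos h]
    have hd2 := ((((hd.const_mul (psi (r * a0 + d'))).sub_const κ).const_mul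
      (Real.exp (-τ * r ^ 2))).div_const (r ^ 2))
    have hd3 := hd2.congr_of_eventuallyEq (f₁ := fun s => Real.exp (-τ * r ^ 2) * (RR d' d a0 a1 b p r s - κ) / r ^ 2) (by
      filter_upwards [hev] with s hs
      unfold RR; rw [hs])
    convert hd3 using 1
    by_cases hr0 : r = 0
    · subst hr0; simp
    · have : ∑ k, Real.cos (r * (b k + p k * 0) + d) * (r * p k) =
          r * ∑ k, p k * Real.sin (r * b k + (d + Real.pi / 2)) := by
        rw [Finset.mul_sum]
        refine Finset.sum_congr rfl fun k _ => ?_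
        rw [← add_assoc, Real.sin_add_pi_div_two, mul_zero, add_zero]; ring
      rw [this]
      generalize ∑ k, p k * Real.sin (r * b k + (d + Real.pi / 2)) = Y
      field_simp

lemma I0 (τ : ℝ) (hτ : 0 < τ) (d' d a : ℝ) (b : Fin 4 → ℝ) (hb : ∑ k, b k = 0)
    (hz : ∀ r, Real.sin (r * a + d') = 0 → ∑ k, Real.sin (r * b k + d) = 0) :
    Integrable (fun r => Real.exp (-τ * r ^ 2) *
      (psi (r * a + d') * ∑ k, Real.sin (r * b k + d) - psi d' * (4 * Real.sin d)) / r ^ 2) := by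
  have hl := RR_lip d' d 0 a 0 b hb (by
    intro r s h
    have := hz (r * s) (by rw [← h]; congr 1; ring)
    rw [← this]
    refine Finset.sum_congr rfl fun k _ => ?_
    simp only [Pi.zero_apply]; ring_nf)
  set K := ∑ k, |b k| * (|(0 : Fin 4 → ℝ) k| + |b k|) with hK
  refine ((integrable_exp_neg_mul_sq hτ).const_mul K).mono' ?_ ?_
  · apply Measurable.aestronglyMeasurable
    have : Measurable fun r => psi (r * a + d') := psi_meas.comp (by fun_prop)
    fun_prop
  · refine Filter.Eventually.of_forall fun r => ?_
    have h := hl r 1 0 (by norm_num) (by norm_num)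
    have hK0 : 0 ≤ K := Finset.sum_nonneg fun k _ => by positivity
    by_cases hr : r = 0
    · subst hr; simp; positivity
    have e : RR d' d 0 a 0 b r 1 - RR d' d 0 a 0 b r 0 =
      psi (r * a + d') * ∑ k, Real.sin (r * b k + d) - psi d' * (4 * Real.sin d) := by
      unfold RR; simp
    rw [e] at h
    rw [mul_div_right_comm, norm_mul, Real.norm_eq_abs, Real.norm_eq_abs, abs_of_nonneg (by positivity)]
    calc _ ≤ (Real.exp (-τ * r ^ 2) / r ^ 2) * ((K * r ^ 2) * |1 - 0|) := by gcongr
      _ = _ := by simp; field_simp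

lemma int_gauss (h : ℝ → ℝ) (c A B : ℝ) (hc : 0 < c) (hm : Measurable h)
    (hb : ∀ v, |h v| ≤ Real.exp (-c * v ^ 2) * (A * |v| + B)) : Integrable h := by
  have i1 : Integrable (fun v : ℝ => Real.exp (-c * v ^ 2) * (A * |v| + B)) := by
    have a1 := ((integrable_mul_exp_neg_mul_sq hc).abs.const_mul A).add
      ((integrable_exp_neg_mul_sq hc).const_mul B)
    refine a1.congr (Filter.Eventually.of_forall fun v => ?_)
    simp only [Pi.add_apply]
    rw [abs_mul, abs_of_pos (Real.exp_pos _)]; ring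
  exact i1.mono' hm.aestronglyMeasurable (Filter.Eventually.of_forall hb)

/-- Gaussian times trigonometric sum. -/
def ff (τ d : ℝ) (w β : Fin 4 → ℝ) (r : ℝ) : ℝ :=
  Real.exp (-τ * r ^ 2) * ∑ k, w k * Real.sin (r * β k + d)

/-- Derivative of `ff`. -/
def fr (τ d : ℝ) (w β : Fin 4 → ℝ) (r : ℝ) : ℝ :=
  Real.exp (-τ * r ^ 2) * (-2 * τ * r * (∑ k, w k * Real.sin (r * β k + d)) +
    ∑ k, w k * β k * Real.cos (r * β k + d))

/-- Gaussian times cosine sum. -/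
def fc (τ d : ℝ) (w p β : Fin 4 → ℝ) (r : ℝ) : ℝ :=
  Real.exp (-τ * r ^ 2) * ∑ k, w k * p k * Real.cos (r * β k + d)

lemma sum_bd (w : Fin 4 → ℝ) (t : Fin 4 → ℝ) (ht : ∀ k, |t k| ≤ 1) :
    |∑ k, w k * t k| ≤ ∑ k, |w k| := by
  refine (Finset.abs_sum_le_sum_abs _ _).trans (Finset.sum_le_sum fun k _ => ?_)
  rw [abs_mul]
  exact mul_le_of_le_one_right (abs_nonneg _) (ht k)

lemma fr_bd (τ d : ℝ) (hτ : 0 < τ) (w β : Fin 4 → ℝ) (r : ℝ) :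
    |fr τ d w β r| ≤ Real.exp (-τ * r ^ 2) * (2 * τ * (∑ k, |w k|) * |r| + ∑ k, |w k * β k|) := by
  unfold fr
  rw [abs_mul, abs_of_pos (Real.exp_pos _)]
  gcongr
  refine (abs_add_le _ _).trans ?_
  have h1 := sum_bd w (fun k => Real.sin (r * β k + d)) fun k => Real.abs_sin_le_one _
  have h2 := sum_bd (fun k => w k * β k) (fun k => Real.cos (r * β k + d)) fun k => Real.abs_cos_le_one _
  refine add_le_add ?_ h2
  rw [abs_mul, abs_mul, abs_mul, abs_of_pos hτ]
  norm_num
  calc _ ≤ 2 * τ * |r| * ∑ k, |w k| := by gcongr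
    _ = _ := by ring

lemma fc_bd (τ d : ℝ) (w p β : Fin 4 → ℝ) (r : ℝ) :
    |fc τ d w p β r| ≤ Real.exp (-τ * r ^ 2) * (∑ k, |w k * p k|) := by
  unfold fc
  rw [abs_mul, abs_of_pos (Real.exp_pos _)]
  gcongr
  exact sum_bd (fun k => w k * p k) (fun k => Real.cos (r * β k + d)) fun k => Real.abs_cos_le_one _

lemma ff_deriv (τ d : ℝ) (w β : Fin 4 → ℝ) (r : ℝ) : HasDerivAt (ff τ d w β) (fr τ d w β r) r := by
  have h1 : HasDerivAt (fun r : ℝ => Real.exp (-τ * r ^ 2)) (Real.exp (-τ * r ^ 2) * (-τ * (2 * r))) r := by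
    apply HasDerivAt.exp
    simpa using (hasDerivAt_pow 2 r).const_mul (-τ)
  have h2 : HasDerivAt (fun r : ℝ => ∑ k, w k * Real.sin (r * β k + d))
      (∑ k, w k * (Real.cos (r * β k + d) * β k)) r := by
    apply HasDerivAt.fun_sum
    intro k _
    apply HasDerivAt.const_mul
    apply HasDerivAt.sin
    simpa using ((hasDerivAt_id r).mul_const (β k)).add_const d
  have h3 := h1.mul h2
  refine h3.congr_deriv ?_
  unfold fr
  have : ∑ k, w k * (Real.cos (r * β k + d) * β k) = ∑ k, w k * β k * Real.cos (r * β k + d) :=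
    Finset.sum_congr rfl fun k _ => by ring
  rw [this]; ring

lemma ff_s_deriv (τ d a0 a1 v : ℝ) (w b p : Fin 4 → ℝ) (s : ℝ) (ha : a0 + a1 * s ≠ 0) :
    HasDerivAt (fun s => ff τ d w (fun k => b k + p k * s) (v / (a0 + a1 * s)))
      (v * (-(a1 / (a0 + a1 * s) ^ 2) * fr τ d w (fun k => b k + p k * s) (v / (a0 + a1 * s))
        + (a0 + a1 * s)⁻¹ * fc τ d w p (fun k => b k + p k * s) (v / (a0 + a1 * s)))) s := by
  have hA : HasDerivAt (fun s => a0 + a1 * s) a1 s := by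
    simpa using ((hasDerivAt_id s).const_mul a1).const_add a0
  have hρ : HasDerivAt (fun s => v / (a0 + a1 * s)) (-(v * a1) / (a0 + a1 * s) ^ 2) s := by
    simpa using (hasDerivAt_const s v).fun_div hA ha
  have h1 := ((hρ.pow 2).const_mul (-τ)).exp
  have h2 : HasDerivAt (fun s => ∑ k, w k * Real.sin (v / (a0 + a1 * s) * (b k + p k * s) + d))
      (∑ k, w k * (Real.cos (v / (a0 + a1 * s) * (b k + p k * s) + d) *
        (-(v * a1) / (a0 + a1 * s) ^ 2 * (b k + p k * s) + v / (a0 + a1 * s) * p k))) s := by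
    apply HasDerivAt.fun_sum
    intro k _
    apply HasDerivAt.const_mul
    apply HasDerivAt.sin
    have hβ : HasDerivAt (fun s => b k + p k * s) (p k) s := by
      simpa using ((hasDerivAt_id s).const_mul (p k)).const_add (b k)
    exact (hρ.mul hβ).add_const d
  have h3 := h1.mul h2
  refine h3.congr_deriv ?_
  unfold fr fc
  have : ∑ k, w k * (Real.cos (v / (a0 + a1 * s) * (b k + p k * s) + d) *
        (-(v * a1) / (a0 + a1 * s) ^ 2 * (b k + p k * s) + v / (a0 + a1 * s) * p k)) =
      -(v * a1) / (a0 + a1 * s) ^ 2 * (∑ k, w k * (b k + p k * s) *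
        Real.cos (v / (a0 + a1 * s) * (b k + p k * s) + d)) + v / (a0 + a1 * s) *
        ∑ k, w k * p k * Real.cos (v / (a0 + a1 * s) * (b k + p k * s) + d) := by
    rw [Finset.mul_sum, Finset.mul_sum, ← Finset.sum_add_distrib]
    exact Finset.sum_congr rfl fun k _ => by ring
  rw [this]
  simp only [Pi.pow_apply]
  push_cast
  ring

lemma ff_small (τ d : ℝ) (w β : Fin 4 → ℝ) (hw : (∑ k, w k) = 0) (r : ℝ) :
    |ff τ d w β r| ≤ Real.exp (-τ * r ^ 2) * ((∑ k, |w k * β k|) * |r|) := by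
  unfold ff
  rw [abs_mul, abs_of_pos (Real.exp_pos _)]
  gcongr
  have : ∑ k, w k * Real.sin (r * β k + d) = ∑ k, w k * (Real.sin (r * β k + d) - Real.sin d) := by
    simp_rw [mul_sub]
    rw [Finset.sum_sub_distrib, ← Finset.sum_mul, hw]; ring
  rw [this, Finset.sum_mul]
  refine (Finset.abs_sum_le_sum_abs _ _).trans (Finset.sum_le_sum fun k _ => ?_)
  rw [abs_mul, abs_mul]
  have := Real.abs_sin_sub_sin_le (r * β k + d) d
  rw [add_sub_cancel_right, abs_mul] at this
  calc _ ≤ |w k| * (|r| * |β k|) := by gcongr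
    _ = _ := by ring

lemma ff_meas (τ d : ℝ) (w β : Fin 4 → ℝ) : Continuous (ff τ d w β) := by
  unfold ff; fun_prop
lemma fr_meas (τ d : ℝ) (w β : Fin 4 → ℝ) : Continuous (fr τ d w β) := by
  unfold fr; fun_prop
lemma fc_meas (τ d : ℝ) (w p β : Fin 4 → ℝ) : Continuous (fc τ d w p β) := by
  unfold fc; fun_prop

lemma psi_mul_int (d : ℝ) (g : ℝ → ℝ) (hg : Integrable g) : Integrable (fun v => psi (v + d) * g v) := by
  refine hg.bdd_mul (c := 1) ?_ ?_
  · exact (psi_meas.comp (measurable_id.add_const d)).aestronglyMeasurable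
  · exact Filter.Eventually.of_forall fun w => psi_abs_le _

lemma subst_int (τ d' d a : ℝ) (ha : a < 0) (w β : Fin 4 → ℝ) :
    ∫ r, Real.exp (-τ * r ^ 2) / r * (psi (r * a + d') * ∑ k, w k * Real.sin (r * β k + d)) =
      -∫ v, v⁻¹ * (psi (v + d') * ff τ d w β (v / a)) := by
  have h := Measure.integral_comp_div (fun r => Real.exp (-τ * r ^ 2) / r *
    (psi (r * a + d') * ∑ k, w k * Real.sin (r * β k + d))) a
  have e : ∀ v : ℝ, Real.exp (-τ * (v / a) ^ 2) / (v / a) *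
    (psi (v / a * a + d') * ∑ k, w k * Real.sin (v / a * β k + d)) =
      a * (v⁻¹ * (psi (v + d') * ff τ d w β (v / a))) := by
    intro v
    rw [div_mul_cancel₀ _ ha.ne]
    unfold ff
    rw [div_div_eq_mul_div]
    ring
  simp_rw [e] at h
  rw [integral_const_mul, abs_of_neg ha, smul_eq_mul] at h
  have := mul_left_cancel₀ ha.ne (h.trans (neg_mul_comm _ _))
  linarith

lemma D1 (τ : ℝ) (hτ : 0 < τ) (d' d a0 a1 : ℝ) (ha : a0 < 0) (w b p : Fin 4 → ℝ) (hw : ∑ k, w k = 0) :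
    HasDerivAt (fun s => ∫ r, Real.exp (-τ * r ^ 2) / r *
        (psi (r * (a0 + a1 * s) + d') * ∑ k, w k * Real.sin (r * (b k + p k * s) + d)))
      ((∫ r, psi (r * a0 + d') * fc τ d w p b r) +
        (a1 / a0) * (-2 * ∑' n : ℤ, (-1 : ℝ) ^ n * ff τ d w b ((Real.pi * n - d') / a0))) 0 := by
  set ε : ℝ := min 1 (|a0| / (2 * (|a1| + 1))) with hε
  have ha' : 0 < |a0| := abs_pos.2 ha.ne
  have hεpos : 0 < ε := by rw [hε]; positivity
  set M := 3 * |a0| / 2 with hM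
  set m := |a0| / 2 with hm
  have hM0 : 0 < M := by positivity
  have hm0 : 0 < m := by positivity
  have hrange : ∀ s ∈ Metric.ball (0:ℝ) ε, |s| ≤ 1 ∧ m ≤ |a0 + a1 * s| ∧ |a0 + a1 * s| ≤ M ∧
      a0 + a1 * s < 0 := by
    intro s hs
    rw [Metric.mem_ball, dist_zero_right, Real.norm_eq_abs] at hs
    have h1 : |s| ≤ 1 := hs.le.trans (min_le_left _ _)
    have h2 : |s| ≤ |a0| / (2 * (|a1| + 1)) := hs.le.trans (min_le_right _ _)
    have h3 : |a1 * s| ≤ |a0| / 2 := by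
      rw [abs_mul]
      rw [le_div_iff₀ (by positivity)] at h2
      nlinarith [abs_nonneg s, abs_nonneg a1]
    have e0 : |a0| = -a0 := abs_of_neg ha
    obtain ⟨h4, h5⟩ := abs_le.1 h3
    have hneg : a0 + a1 * s < 0 := by linarith
    refine ⟨h1, ?_, ?_, hneg⟩
    · rw [abs_of_neg hneg, hm]; linarith
    · rw [abs_of_neg hneg, hM]; linarith
  have hexp : ∀ s ∈ Metric.ball (0:ℝ) ε, ∀ v : ℝ,
      Real.exp (-τ * (v / (a0 + a1 * s)) ^ 2) ≤ Real.exp (-(τ / M ^ 2) * v ^ 2) := by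
    intro s hs v
    obtain ⟨_, h2, h3, h4⟩ := hrange s hs
    apply Real.exp_le_exp.2
    have : τ / M ^ 2 * v ^ 2 ≤ τ * (v / (a0 + a1 * s)) ^ 2 := by
      rw [div_pow v, ← sq_abs (a0 + a1 * s)]
      have hpos : 0 < |a0 + a1 * s| := lt_of_lt_of_le hm0 h2
      calc τ / M ^ 2 * v ^ 2 ≤ τ / |a0 + a1 * s| ^ 2 * v ^ 2 := by gcongr
        _ = _ := by ring
    linarith
  set W := ∑ k, |w k| with hW
  set WB := ∑ k, |w k| * (|b k| + |p k|) with hWB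
  set WP := ∑ k, |w k * p k| with hWP
  have hW0 : 0 ≤ W := Finset.sum_nonneg fun k _ => by positivity
  have hWB0 : 0 ≤ WB := Finset.sum_nonneg fun k _ => by positivity
  have hWP0 : 0 ≤ WP := Finset.sum_nonneg fun k _ => by positivity
  have h0mem : (0:ℝ) ∈ Metric.ball (0:ℝ) ε := Metric.mem_ball_self hεpos
  have hfr : ∀ s ∈ Metric.ball (0:ℝ) ε, ∀ v : ℝ,
      |fr τ d w (fun k => b k + p k * s) (v / (a0 + a1 * s))| ≤
        Real.exp (-(τ / M ^ 2) * v ^ 2) * ((2 * τ * W / m) * |v| + WB) := by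
    intro s hs v
    obtain ⟨h1, h2, h3, h4⟩ := hrange s hs
    refine (fr_bd τ d hτ w _ _).trans ?_
    have e2 : ∑ k, |w k * (b k + p k * s)| ≤ WB := by
      refine Finset.sum_le_sum fun k _ => ?_
      rw [abs_mul]
      gcongr
      calc _ ≤ |b k| + |p k * s| := abs_add_le _ _
        _ ≤ |b k| + |p k| * 1 := by rw [abs_mul]; gcongr
        _ = _ := by ring
    have e3 : 2 * τ * W * |v / (a0 + a1 * s)| ≤ (2 * τ * W / m) * |v| := by
      rw [abs_div]
      calc _ ≤ 2 * τ * W * (|v| / m) := by gcongr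
        _ = _ := by ring
    exact mul_le_mul (hexp s hs v) (add_le_add e3 e2) (by positivity) (by positivity)
  have hfc : ∀ s ∈ Metric.ball (0:ℝ) ε, ∀ v : ℝ,
      |fc τ d w p (fun k => b k + p k * s) (v / (a0 + a1 * s))| ≤
        Real.exp (-(τ / M ^ 2) * v ^ 2) * WP := by
    intro s hs v
    refine (fc_bd τ d w p _ _).trans ?_
    gcongr ?_ * _
    exact hexp s hs v
  have hcpos : 0 < τ / M ^ 2 := by positivity
  have hder := (hasDerivAt_integral_of_dominated_loc_of_deriv_le (μ := volume) (s := Metric.ball (0:ℝ) ε)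
    (x₀ := (0:ℝ))
    (F := fun s v => v⁻¹ * (psi (v + d') * ff τ d w (fun k => b k + p k * s) (v / (a0 + a1 * s))))
    (F' := fun s v => psi (v + d') * (-(a1 / (a0 + a1 * s) ^ 2) *
        fr τ d w (fun k => b k + p k * s) (v / (a0 + a1 * s))
        + (a0 + a1 * s)⁻¹ * fc τ d w p (fun k => b k + p k * s) (v / (a0 + a1 * s))))
    (bound := fun v => Real.exp (-(τ / M ^ 2) * v ^ 2) *
      ((|a1| / m ^ 2 * (2 * τ * W / m)) * |v| + (|a1| / m ^ 2 * WB + WP / m)))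
    (Metric.ball_mem_nhds _ hεpos) ?_ ?_ ?_ ?_ ?_ ?_).2
  · have hev : (fun s => ∫ r, Real.exp (-τ * r ^ 2) / r *
        (psi (r * (a0 + a1 * s) + d') * ∑ k, w k * Real.sin (r * (b k + p k * s) + d))) =ᶠ[nhds 0]
        fun s => -∫ v, v⁻¹ * (psi (v + d') * ff τ d w (fun k => b k + p k * s) (v / (a0 + a1 * s))) := by
      filter_upwards [Metric.ball_mem_nhds (0:ℝ) hεpos] with s hs
      exact subst_int τ d' d _ (hrange s hs).2.2.2 w _
    refine (hder.neg.congr_of_eventuallyEq hev).congr_deriv ?_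
    simp only [mul_zero, add_zero]
    have i1 : Integrable (fun v => fr τ d w b (v / a0)) := by
      refine int_gauss _ _ (2 * τ * W / m) WB hcpos ((fr_meas τ d w b).measurable.comp (by fun_prop)) fun v => ?_
      simpa using hfr 0 h0mem v
    have i2 : Integrable (fun v => fc τ d w p b (v / a0)) := by
      refine int_gauss _ _ 0 WP hcpos ((fc_meas τ d w p b).measurable.comp (by fun_prop)) fun v => ?_
      simpa using hfc 0 h0mem v
    have j1 := psi_mul_int d' _ i1
    have j2 := psi_mul_int d' _ i2
    have esplit : ∫ v, psi (v + d') * (-(a1 / a0 ^ 2) * fr τ d w b (v / a0) +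
        a0⁻¹ * fc τ d w p b (v / a0)) = -(a1 / a0 ^ 2) * (∫ v, psi (v + d') * fr τ d w b (v / a0)) +
        a0⁻¹ * ∫ v, psi (v + d') * fc τ d w p b (v / a0) := by
      rw [← integral_const_mul, ← integral_const_mul, ← integral_add (j1.const_mul _) (j2.const_mul _)]
      congr 1; funext v; ring
    have esub := Measure.integral_comp_div (fun r => psi (r * a0 + d') * fc τ d w p b r) a0
    simp_rw [div_mul_cancel₀ _ ha.ne] at esub
    rw [smul_eq_mul, abs_of_neg ha] at esub
    have ej := jump (fun v => ff τ d w b (v / a0)) (fun v => fr τ d w b (v / a0) / a0) d' ?_ ?_ ?_ ?_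
    · have e4 : ∫ v, psi (v + d') * fr τ d w b (v / a0) =
          a0 * ∫ v, psi (v + d') * (fr τ d w b (v / a0) / a0) := by
        rw [← integral_const_mul]
        congr 1; funext v
        field_simp [ha.ne]
      rw [esplit, esub, e4, ej]
      field_simp [ha.ne]
      ring
    · intro v
      have := (ff_deriv τ d w b (v / a0)).comp v ((hasDerivAt_id v).div_const a0)
      refine this.congr_deriv ?_
      ring
    · have := fr_meas τ d w b
      fun_prop
    · exact i1.div_const a0
    · refine Summable.of_norm_bounded ((gauss_summable (τ / M ^ 2) d' hcpos).mul_right W) fun n => ?_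
      have hb := hexp 0 h0mem (Real.pi * n - d')
      simp only [mul_zero, add_zero] at hb
      have h1 := sum_bd w (fun k => Real.sin ((Real.pi * n - d') / a0 * b k + d))
        fun k => Real.abs_sin_le_one _
      unfold ff
      rw [norm_mul, Real.norm_eq_abs, Real.norm_eq_abs, abs_of_pos (Real.exp_pos _)]
      gcongr
  · refine Filter.Eventually.of_forall fun s => Measurable.aestronglyMeasurable ?_
    have h1 : Measurable fun v => psi (v + d') := psi_meas.comp (by fun_prop)
    have h2 : Measurable fun v => ff τ d w (fun k => b k + p k * s) (v / (a0 + a1 * s)) :=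
      (ff_meas τ d w _).measurable.comp (by fun_prop)
    fun_prop
  · refine int_gauss _ (τ / M ^ 2) 0 ((∑ k, |w k * b k|) / |a0|) hcpos ?_ ?_
    · have h1 : Measurable fun v => psi (v + d') := psi_meas.comp (by fun_prop)
      have h2 : Measurable fun v => ff τ d w (fun k => b k + p k * 0) (v / (a0 + a1 * 0)) :=
        (ff_meas τ d w _).measurable.comp (by fun_prop)
      fun_prop
    · intro v
      by_cases hv : v = 0
      · subst hv; simp; positivity
      have h1 := ff_small τ d w b hw (v / a0)
      have hb := hexp 0 h0mem v
      simp only [mul_zero, add_zero] at hb ⊢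
      rw [abs_mul, abs_mul, abs_inv]
      have hv' : 0 < |v| := abs_pos.2 hv
      calc _ ≤ |v|⁻¹ * (1 * (Real.exp (-(τ / M ^ 2) * v ^ 2) * ((∑ k, |w k * b k|) * |v / a0|))) := by
            gcongr
            · exact psi_abs_le _
            · exact h1.trans (by gcongr)
        _ = _ := by
          rw [abs_div]; field_simp; ring
  · apply Measurable.aestronglyMeasurable
    have h1 : Measurable fun v => psi (v + d') := psi_meas.comp (by fun_prop)
    have h2 : Measurable fun v => fr τ d w (fun k => b k + p k * 0) (v / (a0 + a1 * 0)) :=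
      (fr_meas τ d w _).measurable.comp (by fun_prop)
    have h3 : Measurable fun v => fc τ d w p (fun k => b k + p k * 0) (v / (a0 + a1 * 0)) :=
      (fc_meas τ d w p _).measurable.comp (by fun_prop)
    fun_prop
  · refine Filter.Eventually.of_forall fun v s hs => ?_
    obtain ⟨h1, h2, h3, h4⟩ := hrange s hs
    have b1 := hfr s hs v
    have b2 := hfc s hs v
    set X := fr τ d w (fun k => b k + p k * s) (v / (a0 + a1 * s))
    set Y := fc τ d w p (fun k => b k + p k * s) (v / (a0 + a1 * s))
    set E := Real.exp (-(τ / M ^ 2) * v ^ 2)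
    have hE : 0 < E := Real.exp_pos _
    have hpos : 0 < |a0 + a1 * s| := lt_of_lt_of_le hm0 h2
    rw [Real.norm_eq_abs, abs_mul]
    have c1 : |-(a1 / (a0 + a1 * s) ^ 2) * X| ≤ |a1| / m ^ 2 * (E * ((2 * τ * W / m) * |v| + WB)) := by
      rw [abs_mul, abs_neg, abs_div, abs_pow]
      gcongr
    have c2 : |(a0 + a1 * s)⁻¹ * Y| ≤ m⁻¹ * (E * WP) := by
      rw [abs_mul, abs_inv]
      gcongr
    calc _ ≤ 1 * (|a1| / m ^ 2 * (E * ((2 * τ * W / m) * |v| + WB)) + m⁻¹ * (E * WP)) := by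
          gcongr
          · exact psi_abs_le _
          · exact (abs_add_le _ _).trans (add_le_add c1 c2)
      _ = _ := by ring
  · exact int_gauss _ (τ / M ^ 2) (|a1| / m ^ 2 * (2 * τ * W / m)) (|a1| / m ^ 2 * WB + WP / m) hcpos (by fun_prop) fun v => by
      rw [abs_of_nonneg (by positivity)]
  · have : ∀ᵐ v : ℝ, v ≠ 0 := by
      filter_upwards [(Set.countable_singleton (0:ℝ)).ae_notMem volume] with v hv h
      exact hv (by simp [h])
    filter_upwards [this] with v hv s hs
    have h4 := (hrange s hs).2.2.2
    have h := ((ff_s_deriv τ d a0 a1 v w b p s h4.ne).const_mul (psi (v + d'))).const_mul v⁻¹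
    refine h.congr_deriv ?_
    field_simp

lemma dot_update (a z : Fin 4 → ℝ) (i : Fin 4) (s : ℝ) :
    dot a (Function.update z i s) = dot a z + a i * (s - z i) := by
  unfold dot
  fin_cases i <;> simp [Fin.sum_univ_four, Function.update] <;> ring

lemma alph_sum (i : Fin 4) : ∑ k, alph k i = 0 := by
  fin_cases i <;> simp [Fin.sum_univ_four, alph] <;> ring

lemma dot_alph_sum (z : Fin 4 → ℝ) : ∑ k, dot (alph k) z = 0 := by
  unfold dot
  rw [Finset.sum_comm]
  simp_rw [← Finset.sum_mul, alph_sum]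
  simp

lemma pair1 (z : Fin 4 → ℝ) : dot (alph 0) z + dot (alph 1) z = 2 * dot theta z := by
  simp [dot, Fin.sum_univ_four, alph, theta]; ring

lemma pair2 (z : Fin 4 → ℝ) : dot (alph 2) z + dot (alph 3) z = -(2 * dot theta z) := by
  simp [dot, Fin.sum_univ_four, alph, theta]; ring

lemma zero_sin (z : Fin 4 → ℝ) (r : ℝ) (h : Real.sin (r * dot theta z + 0) = 0) :
    ∑ k, Real.sin (r * dot (alph k) z + 0) = 0 := by
  simp only [add_zero] at *
  have h1 : Real.sin (r * dot (alph 0) z) + Real.sin (r * dot (alph 1) z) = 0 := by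
    rw [Real.sin_add_sin, ← mul_add, pair1, show r * (2 * dot theta z) / 2 = r * dot theta z by ring, h]
    simp
  have h2 : Real.sin (r * dot (alph 2) z) + Real.sin (r * dot (alph 3) z) = 0 := by
    rw [Real.sin_add_sin, ← mul_add, pair2, show r * -(2 * dot theta z) / 2 = -(r * dot theta z) by ring,
      Real.sin_neg, h]
    simp
  rw [Fin.sum_univ_four]; linarith

lemma zero_cos (z : Fin 4 → ℝ) (r : ℝ) (h : Real.sin (r * dot theta z + Real.pi / 2) = 0) :
    ∑ k, Real.sin (r * dot (alph k) z + Real.pi / 2) = 0 := by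
  simp only [Real.sin_add_pi_div_two] at *
  have h1 : Real.cos (r * dot (alph 0) z) + Real.cos (r * dot (alph 1) z) = 0 := by
    rw [Real.cos_add_cos, ← mul_add, pair1, show r * (2 * dot theta z) / 2 = r * dot theta z by ring, h]
    simp
  have h2 : Real.cos (r * dot (alph 2) z) + Real.cos (r * dot (alph 3) z) = 0 := by
    rw [Real.cos_add_cos, ← mul_add, pair2, show r * -(2 * dot theta z) / 2 = -(r * dot theta z) by ring,
      Real.cos_neg, h]
    simp
  rw [Fin.sum_univ_four]; linarith

/-- Strictly sorted points. -/
def Srt (z : Fin 4 → ℝ) : Prop := z 0 < z 1 ∧ z 1 < z 2 ∧ z 2 < z 3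

lemma sortv_eq (z : Fin 4 → ℝ) (h : Srt z) : sortv z = z := by
  have hm : Monotone z := by
    apply Fin.monotone_iff_le_succ.2
    intro i
    obtain ⟨h1, h2, h3⟩ := h
    fin_cases i
    · exact h1.le
    · exact h2.le
    · exact h3.le
  unfold sortv
  rw [Tuple.sort_eq_refl_iff_monotone.2 hm]
  rfl

lemma theta_neg (z : Fin 4 → ℝ) (h : Srt z) : dot theta z < 0 := by
  obtain ⟨h1, h2, h3⟩ := h
  have : dot theta z = (1 / Real.sqrt 2) * (z 0 + z 1 - z 2 - z 3) := by
    simp [dot, Fin.sum_univ_four, theta]; ring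
  rw [this]
  have : 0 < 1 / Real.sqrt 2 := by positivity
  nlinarith

lemma srt_ev (z : Fin 4 → ℝ) (h : Srt z) (i : Fin 4) :
    ∀ᶠ s in nhds (z i), Srt (Function.update z i s) := by
  have ho : IsOpen {y : Fin 4 → ℝ | Srt y} := by
    unfold Srt
    exact (isOpen_lt (continuous_apply 0) (continuous_apply 1)).inter
      ((isOpen_lt (continuous_apply 1) (continuous_apply 2)).inter
        (isOpen_lt (continuous_apply 2) (continuous_apply 3)))
  have hc : Continuous fun s => Function.update z i s := by fun_prop
  apply hc.continuousAt.eventually_mem (ho.mem_nhds _)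
  simpa using h

/-- One of the two integrals making up `u`. -/
def HH (τ d : ℝ) (z : Fin 4 → ℝ) : ℝ :=
  ∫ r, Real.exp (-τ * r ^ 2) *
      (psi (r * dot theta z + d) * ∑ k, Real.sin (r * dot (alph k) z + d) - psi d * (4 * Real.sin d)) / r ^ 2

/-- One of the two integrals making up the gradient. -/
def QQ (τ d e : ℝ) (i : Fin 4) (z : Fin 4 → ℝ) : ℝ :=
  ∫ r, Real.exp (-τ * r ^ 2) / r * (psi (r * dot theta z + d) *
        ∑ k, alph k i * Real.sin (r * dot (alph k) z + e))

lemma u_eq (T t : ℝ) (htT : t < T) (z : Fin 4 → ℝ) (h : Srt z) :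
    u T t z = -(1 / (16 * Real.sqrt 2)) * (HH (T - t) (Real.pi / 2) z - HH (T - t) 0 z)
      + (1 / 4) * ∑ i, z i + (1 / 2) * Real.sqrt ((T - t) * Real.pi / 2) := by
  have hτ : 0 < T - t := by linarith
  unfold u
  rw [sortv_eq z h]
  congr 3
  unfold HH
  rw [← integral_sub (I0 _ hτ _ _ _ _ (dot_alph_sum z) (zero_cos z))
    (I0 _ hτ _ _ _ _ (dot_alph_sum z) (zero_sin z))]
  congr 1
  funext r
  have p1 : psi (Real.pi / 2) = 1 := by unfold psi; simp [Real.sign_one]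
  have p0 : psi 0 = 0 := by unfold psi; simp
  rw [p1, p0]
  unfold Lam
  simp only [Real.sin_add_pi_div_two, add_zero, Real.sin_pi_div_two]
  ring

lemma HH_deriv (τ d : ℝ) (hτ : 0 < τ) (z : Fin 4 → ℝ) (h : Srt z) (i : Fin 4)
    (hz : ∀ z r, Real.sin (r * dot theta z + d) = 0 → ∑ k, Real.sin (r * dot (alph k) z + d) = 0) :
    HasDerivAt (fun s => HH τ d (Function.update z i s)) (QQ τ d (d + Real.pi / 2) i z) (z i) := by
  have h0 := D0 τ hτ d d (psi d * (4 * Real.sin d)) (dot theta z) (theta i) (theta_neg z h).ne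
    (fun k => dot (alph k) z) (fun k => alph k i) (alph_sum i) (by
      intro r s hs
      have := hz (Function.update z i (z i + s)) r (by rw [dot_update, ← hs]; congr 3; ring)
      rw [← this]
      refine Finset.sum_congr rfl fun k _ => ?_
      rw [dot_update]; congr 3; ring) (by
      have := I0 τ hτ d d (dot theta z) (fun k => dot (alph k) z) (dot_alph_sum z) (hz z)
      simpa [RR] using this)
  have h1 : HasDerivAt (fun s => s - z i) 1 (z i) := (hasDerivAt_id _).sub_const _
  have h2 := HasDerivAt.comp_of_eq (z i) h0 h1 (sub_self _).symm
  rw [mul_one] at h2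
  refine h2.congr_of_eventuallyEq (Filter.Eventually.of_forall fun s => ?_)
  simp only [HH, RR, Function.comp, dot_update]

lemma pd_eq (T t : ℝ) (htT : t < T) (z : Fin 4 → ℝ) (h : Srt z) (i : Fin 4) :
    pd i (u T t) z = -(1 / (16 * Real.sqrt 2)) * (QQ (T - t) (Real.pi / 2) (Real.pi / 2 + Real.pi / 2) i z
      - QQ (T - t) 0 (0 + Real.pi / 2) i z) + 1 / 4 := by
  have hτ : 0 < T - t := by linarith
  unfold pd
  apply HasDerivAt.deriv
  have h1 := HH_deriv (T - t) (Real.pi / 2) hτ z h i zero_cos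
  have h2 := HH_deriv (T - t) 0 hτ z h i zero_sin
  have h3 : HasDerivAt (fun s => (1 / 4) * ∑ k, Function.update z i s k) (1 / 4) (z i) := by
    have : ∀ s, (1 / 4) * ∑ k, Function.update z i s k = (1/4) * (∑ k, z k) + (1 / 4) * (s - z i) := by
      intro s
      have := dot_update (fun _ => 1) z i s
      simp only [dot, one_mul] at this
      rw [this]; ring
    simp_rw [this]
    simpa using (((hasDerivAt_id (z i)).sub_const (z i)).const_mul ((1:ℝ)/4)).const_add ((1/4) * (∑ k, z k))
  have h4 := (((h1.sub h2).const_mul (-(1 / (16 * Real.sqrt 2)))).add h3).add_const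
    ((1 / 2) * Real.sqrt ((T - t) * Real.pi / 2))
  refine h4.congr_of_eventuallyEq ?_
  filter_upwards [srt_ev z h i] with s hs
  rw [u_eq T t htT _ hs]
  rfl

lemma QQ_deriv (τ d e : ℝ) (hτ : 0 < τ) (x : Fin 4 → ℝ) (h : Srt x) (i j : Fin 4) :
    HasDerivAt (fun s => QQ τ d e i (Function.update x j s))
      ((∫ r, psi (r * dot theta x + d) * fc τ e (fun k => alph k i) (fun k => alph k j)
          (fun k => dot (alph k) x) r) +
        (theta j / dot theta x) * (-2 * ∑' n : ℤ, (-1 : ℝ) ^ n *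
          ff τ e (fun k => alph k i) (fun k => dot (alph k) x) ((Real.pi * n - d) / dot theta x))) (x j) := by
  have h0 := D1 τ hτ d e (dot theta x) (theta j) (theta_neg x h) (fun k => alph k i)
    (fun k => dot (alph k) x) (fun k => alph k j) (alph_sum i)
  have h1 : HasDerivAt (fun s => s - x j) 1 (x j) := (hasDerivAt_id _).sub_const _
  have h2 := HasDerivAt.comp_of_eq (x j) h0 h1 (sub_self _).symm
  rw [mul_one] at h2
  refine h2.congr_of_eventuallyEq (Filter.Eventually.of_forall fun s => ?_)
  simp only [QQ, Function.comp, dot_update]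

lemma fc_int (τ d e a : ℝ) (hτ : 0 < τ) (w p β : Fin 4 → ℝ) :
    Integrable (fun r => psi (r * a + d) * fc τ e w p β r) := by
  refine int_gauss _ τ 0 (∑ k, |w k * p k|) hτ ?_ ?_
  · exact (psi_meas.comp (by fun_prop)).mul (fc_meas τ e w p β).measurable
  · intro v
    rw [abs_mul, zero_mul, zero_add]
    calc _ ≤ 1 * (Real.exp (-τ * v ^ 2) * ∑ k, |w k * p k|) := by
          gcongr
          · exact psi_abs_le _
          · exact fc_bd _ _ _ _ _ _
      _ = _ := one_mul _

/-- explicit second partial derivatives of u^T at strictly sorted points. -/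
theorem u_second_partial (T t : ℝ) (ht : 0 ≤ t) (htT : t < T) (x : Fin 4 → ℝ)
    (h01 : x 0 < x 1) (h12 : x 1 < x 2) (h23 : x 2 < x 3) (i j : Fin 4) :
    HasDerivAt (fun s => pd i (u T t) (Function.update x j s))
      ((1 / (16 * Real.sqrt 2)) *
          (∫ r : ℝ, Real.exp (-(T - t) * r ^ 2) *
            ∑ k, alph k i * alph k j *
              (psi (r * dot theta x + Real.pi / 2) * Real.cos (r * dot (alph k) x)
                - psi (r * dot theta x) * Real.sin (r * dot (alph k) x)))
        + (theta j / (16 * Real.sqrt 2)) *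
            ∑' l : ℤ, ((-1 : ℝ) ^ l *
                Real.exp (-(T - t) * (Real.pi * ((l : ℝ) + 1 / 2)) ^ 2 / (dot theta x) ^ 2)
                / dot theta x) *
              ∑ k, 2 * alph k i *
                Real.sin (dot (alph k) x * Real.pi * ((l : ℝ) + 1 / 2) / dot theta x)
        - (theta j / (16 * Real.sqrt 2)) *
            ∑' l : ℤ, ((-1 : ℝ) ^ l *
                Real.exp (-(T - t) * (Real.pi * (l : ℝ)) ^ 2 / (dot theta x) ^ 2)
                / dot theta x) *
              ∑ k, 2 * alph k i *
                Real.cos (dot (alph k) x * Real.pi * (l : ℝ) / dot theta x))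
      (x j) := by
  have hs : Srt x := ⟨h01, h12, h23⟩
  have hτ : 0 < T - t := by linarith
  have ha := theta_neg x hs
  have q1 := QQ_deriv (T - t) (Real.pi / 2) (Real.pi / 2 + Real.pi / 2) hτ x hs i j
  have q2 := QQ_deriv (T - t) 0 (0 + Real.pi / 2) hτ x hs i j
  have q3 := ((q1.sub q2).const_mul (-(1 / (16 * Real.sqrt 2)))).add_const (1 / 4)
  have hev : (fun s => pd i (u T t) (Function.update x j s)) =ᶠ[nhds (x j)] fun s =>
      -(1 / (16 * Real.sqrt 2)) * (QQ (T - t) (Real.pi / 2) (Real.pi / 2 + Real.pi / 2) i (Function.update x j s)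
      - QQ (T - t) 0 (0 + Real.pi / 2) i (Function.update x j s)) + 1 / 4 := by
    filter_upwards [srt_ev x hs j] with s hs'
    exact pd_eq T t htT _ hs' i
  refine (q3.congr_of_eventuallyEq hev).congr_deriv ?_
  rw [zero_add, add_halves]
  have eI : ∫ r : ℝ, Real.exp (-(T - t) * r ^ 2) *
            ∑ k, alph k i * alph k j *
              (psi (r * dot theta x + Real.pi / 2) * Real.cos (r * dot (alph k) x)
                - psi (r * dot theta x) * Real.sin (r * dot (alph k) x)) =
      -((∫ r, psi (r * dot theta x + Real.pi / 2) * fc (T - t) Real.pi (fun k => alph k i) (fun k => alph k j)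
          (fun k => dot (alph k) x) r) - ∫ r, psi (r * dot theta x + 0) *
          fc (T - t) (Real.pi / 2) (fun k => alph k i) (fun k => alph k j)
          (fun k => dot (alph k) x) r) := by
    rw [← integral_sub (fc_int _ _ _ _ hτ _ _ _) (fc_int _ _ _ _ hτ _ _ _), ← integral_neg]
    congr 1
    funext r
    unfold fc
    simp only [Real.cos_add_pi, Real.cos_add_pi_div_two, add_zero, Fin.sum_univ_four]
    ring
  have eA : ∑' n : ℤ, (-1 : ℝ) ^ n * ff (T - t) Real.pi (fun k => alph k i) (fun k => dot (alph k) x)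
        ((Real.pi * n - Real.pi / 2) / dot theta x) =
      (dot theta x / 2) * ∑' l : ℤ, ((-1 : ℝ) ^ l *
                Real.exp (-(T - t) * (Real.pi * ((l : ℝ) + 1 / 2)) ^ 2 / (dot theta x) ^ 2)
                / dot theta x) *
              ∑ k, 2 * alph k i *
                Real.sin (dot (alph k) x * Real.pi * ((l : ℝ) + 1 / 2) / dot theta x) := by
    rw [← tsum_mul_left, ← Equiv.tsum_eq (Equiv.addRight (1 : ℤ))]
    congr 1
    funext l
    simp only [Equiv.coe_addRight, ff, Real.sin_add_pi]
    rw [zpow_add_one₀ (by norm_num)]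
    push_cast
    have e1 : (Real.pi * ((l : ℝ) + 1) - Real.pi / 2) / dot theta x =
      Real.pi * ((l : ℝ) + 1 / 2) / dot theta x := by ring
    have e2 : ∀ k, dot (alph k) x * Real.pi * ((l : ℝ) + 1 / 2) / dot theta x =
      Real.pi * ((l : ℝ) + 1 / 2) / dot theta x * dot (alph k) x := fun k => by ring
    simp only [e1, e2]
    rw [div_pow, mul_div_assoc (-(T - t))]
    simp only [Fin.sum_univ_four]
    generalize Real.exp _ = E
    generalize (-1 : ℝ) ^ l = N
    have hc : dot theta x * (dot theta x)⁻¹ = 1 := mul_inv_cancel₀ ha.ne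
    rw [div_eq_mul_inv (N * E)]
    linear_combination (-(N * E) * (alph 0 i * Real.sin (Real.pi * ((l : ℝ) + 1 / 2) / dot theta x * dot (alph 0) x)
      + alph 1 i * Real.sin (Real.pi * ((l : ℝ) + 1 / 2) / dot theta x * dot (alph 1) x)
      + alph 2 i * Real.sin (Real.pi * ((l : ℝ) + 1 / 2) / dot theta x * dot (alph 2) x)
      + alph 3 i * Real.sin (Real.pi * ((l : ℝ) + 1 / 2) / dot theta x * dot (alph 3) x))) * hc
  have eB : ∑' n : ℤ, (-1 : ℝ) ^ n * ff (T - t) (Real.pi / 2) (fun k => alph k i) (fun k => dot (alph k) x)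
        ((Real.pi * n - 0) / dot theta x) =
      (dot theta x / 2) * ∑' l : ℤ, ((-1 : ℝ) ^ l *
                Real.exp (-(T - t) * (Real.pi * (l : ℝ)) ^ 2 / (dot theta x) ^ 2)
                / dot theta x) *
              ∑ k, 2 * alph k i *
                Real.cos (dot (alph k) x * Real.pi * (l : ℝ) / dot theta x) := by
    rw [← tsum_mul_left]
    congr 1
    funext l
    simp only [ff, Real.sin_add_pi_div_two, sub_zero]
    have e2 : ∀ k, dot (alph k) x * Real.pi * (l : ℝ) / dot theta x =
      Real.pi * (l : ℝ) / dot theta x * dot (alph k) x := fun k => by ring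
    simp only [e2]
    rw [div_pow, mul_div_assoc (-(T - t))]
    simp only [Fin.sum_univ_four]
    generalize Real.exp _ = E
    generalize (-1 : ℝ) ^ l = N
    have hc : dot theta x * (dot theta x)⁻¹ = 1 := mul_inv_cancel₀ ha.ne
    rw [div_eq_mul_inv (N * E)]
    linear_combination (-(N * E) * (alph 0 i * Real.cos (Real.pi * (l : ℝ) / dot theta x * dot (alph 0) x)
      + alph 1 i * Real.cos (Real.pi * (l : ℝ) / dot theta x * dot (alph 1) x)
      + alph 2 i * Real.cos (Real.pi * (l : ℝ) / dot theta x * dot (alph 2) x)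
      + alph 3 i * Real.cos (Real.pi * (l : ℝ) / dot theta x * dot (alph 3) x))) * hc
  rw [eI, eA, eB]
  generalize (∑' l : ℤ, ((-1 : ℝ) ^ l *
                Real.exp (-(T - t) * (Real.pi * ((l : ℝ) + 1 / 2)) ^ 2 / (dot theta x) ^ 2)
                / dot theta x) *
              ∑ k, 2 * alph k i *
                Real.sin (dot (alph k) x * Real.pi * ((l : ℝ) + 1 / 2) / dot theta x)) = S1
  generalize (∑' l : ℤ, ((-1 : ℝ) ^ l *
                Real.exp (-(T - t) * (Real.pi * (l : ℝ)) ^ 2 / (dot theta x) ^ 2)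
                / dot theta x) *
              ∑ k, 2 * alph k i *
                Real.cos (dot (alph k) x * Real.pi * (l : ℝ) / dot theta x)) = S2
  have hc : dot theta x * (dot theta x)⁻¹ = 1 := mul_inv_cancel₀ ha.ne
  rw [div_eq_mul_inv (theta j) (dot theta x)]
  linear_combination ((theta j / (16 * Real.sqrt 2)) * (S1 - S2)) * hc

end
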